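/- Let C and C′ be Clifford unitaries on n qubits. Then the flow tableau of the concatenated circuit satisfies F(C′·C) = F(C′) ⊛ F(C), where the right-hand side is the row-wise ⊛-product of tableaus. -/

import Mathlib

open Matrix

abbrev GG (n : ℕ) := ZMod 4 × (Fin n → ZMod 2) × (Fin n → ZMod 2)

def dotF2 {n : ℕ} (a b : Fin n → ZMod 2) : ZMod 2 := ∑ j, a j * b j

def lift24 (x : ZMod 2) : ZMod 4 := (x.val : ZMod 4)

def gop {n : ℕ} (p q : GG n) : GG n :=
  (p.1 + q.1 + 2 * lift24 (dotF2 p.2.2 q.2.1), p.2.1 + q.2.1, p.2.2 + q.2.2)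

abbrev PMat (n : ℕ) := Matrix (Fin n → ZMod 2) (Fin n → ZMod 2) ℂ

noncomputable def PauliOp {n : ℕ} (ε : ZMod 4) (ξ ζ : Fin n → ZMod 2) : PMat n :=
  fun u v => Complex.I ^ ε.val * (-1 : ℂ) ^ (dotF2 ζ v).val * (if u = v + ξ then 1 else 0)

def eVec {n : ℕ} (t : Fin n) : Fin n → ZMod 2 := fun j => if j = t then 1 else 0

/-- A Clifford unitary: a unitary matrix normalizing the Pauli group
(under right conjugation C† P C). -/
def IsCliffordUnitary {n : ℕ} (C : PMat n) : Prop :=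
  C * Cᴴ = 1 ∧ Cᴴ * C = 1 ∧
  ∀ p : GG n, ∃ q : GG n, Cᴴ * PauliOp p.1 p.2.1 p.2.2 * C = PauliOp q.1 q.2.1 q.2.2

/-- The generators g₀ = iI, g_j = P(0,e_j,0) (1 ≤ j ≤ n), g_{n+j} = P(0,0,e_j). -/
noncomputable def gens (n : ℕ) (i : Fin (2 * n + 1)) : PMat n :=
  if _h0 : i.val = 0 then Complex.I • (1 : PMat n)
  else if h1 : i.val ≤ n then PauliOp 0 (eVec ⟨i.val - 1, by have := i.isLt; omega⟩) 0
  else PauliOp 0 0 (eVec ⟨i.val - 1 - n, by have := i.isLt; omega⟩)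

/-- M is the flow tableau of C: row i presents C† gᵢ C, i.e. ρ(C† gᵢ C) = Mᵢ. -/
def IsFlowTableau {n : ℕ} (C : PMat n) (M : Fin (2 * n + 1) → GG n) : Prop :=
  ∀ i, PauliOp (M i).1 (M i).2.1 (M i).2.2 = Cᴴ * gens n i * C

/-- M is the Clifford tableau of C: row i presents C gᵢ C†, i.e. ρ(C gᵢ C†) = Mᵢ. -/
def IsCliffordTableau {n : ℕ} (C : PMat n) (M : Fin (2 * n + 1) → GG n) : Prop :=
  ∀ i, PauliOp (M i).1 (M i).2.1 (M i).2.2 = C * gens n i * Cᴴ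

/-- Row index 1,…,2n of a tableau, indexed by Fin n ⊕ Fin n. -/
def rowIdx (n : ℕ) : Fin n ⊕ Fin n → Fin (2 * n + 1)
  | .inl j => ⟨j.val + 1, by have := j.isLt; omega⟩
  | .inr j => ⟨n + j.val + 1, by have := j.isLt; omega⟩

/-- The phaseless 2n×2n block of a tableau over 𝔽₂: row i is (ξᵢ | ζᵢ). -/
def tabBlock {n : ℕ} (M : Fin (2 * n + 1) → GG n) :
    Matrix (Fin n ⊕ Fin n) (Fin n ⊕ Fin n) (ZMod 2) :=
  fun i => Sum.elim (M (rowIdx n i)).2.1 (M (rowIdx n i)).2.2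

/-- Ω = ((0,I),(I,0)). -/
def Ωblk (n : ℕ) : Matrix (Fin n ⊕ Fin n) (Fin n ⊕ Fin n) (ZMod 2) :=
  Matrix.fromBlocks 0 1 1 0

/-- The i-th bit (1 ≤ i ≤ 2n) of the phaseless part of ϱ ∈ Gₙ. -/
def bitOf {n : ℕ} (ϱ : GG n) (i : Fin (2 * n)) : ZMod 2 :=
  if h : i.val < n then ϱ.2.1 ⟨i.val, h⟩
  else ϱ.2.2 ⟨i.val - n, by have := i.isLt; omega⟩

/-- The vector–tableau product ϱ ⊛ M := (ϱ₀·ε₀|0|0) ⊛ m_{i₁} ⊛ ⋯ ⊛ m_{i_k}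
over the indices i ≥ 1 with ϱᵢ = 1, in increasing order. -/
def starVecMul {n : ℕ} (ϱ : GG n) (M : Fin (2 * n + 1) → GG n) : GG n :=
  (((List.finRange (2 * n)).filter (fun i => decide (bitOf ϱ i = 1))).map
    (fun i => M i.succ)).foldl gop (ϱ.1 * (M 0).1, 0, 0)

/-- The Pauli matrix presented by an element of `GG n`. -/
noncomputable def pauliOf {n : ℕ} (p : GG n) : PMat n := PauliOp p.1 p.2.1 p.2.2

/-- The element of `GG n` presenting the generator with index `i + 1`. -/
def genTuple {n : ℕ} (i : Fin (2 * n)) : GG n :=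
  if h : i.val < n then (0, eVec ⟨i.val, h⟩, 0)
  else (0, 0, eVec ⟨i.val - n, by have := i.isLt; omega⟩)

theorem I_pow_val_add (a b : ZMod 4) :
    Complex.I ^ (a + b).val = Complex.I ^ a.val * Complex.I ^ b.val := by
  rw [ZMod.val_add, ← pow_add, pow_eq_pow_mod (a.val + b.val) Complex.I_pow_four]

theorem neg_one_pow_val_add (a b : ZMod 2) :
    (-1 : ℂ) ^ (a + b).val = (-1) ^ a.val * (-1) ^ b.val := by
  rw [ZMod.val_add, ← pow_add, pow_eq_pow_mod (a.val + b.val) (by norm_num : (-1 : ℂ) ^ 2 = 1)]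

theorem I_pow_val_two_mul_lift24 (x : ZMod 2) :
    Complex.I ^ (2 * lift24 x).val = (-1 : ℂ) ^ x.val := by
  have h : (2 * lift24 x).val = 2 * x.val := by revert x; decide
  rw [h, pow_mul, Complex.I_sq]

theorem I_pow_val_injective : Function.Injective fun a : ZMod 4 => Complex.I ^ a.val := by
  have h : ∀ a : ZMod 4, Complex.I ^ a.val = 1 → a = 0 := by
    intro a ha
    obtain rfl | rfl | rfl | rfl : a = 0 ∨ a = 1 ∨ a = 2 ∨ a = 3 := by clear ha; revert a; decide
    · rfl
    · simp [show (1 : ZMod 4).val = 1 from rfl, Complex.ext_iff] at ha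
    · simp only [show (2 : ZMod 4).val = 2 from rfl, Complex.I_sq] at ha
      norm_num at ha
    · simp [show (3 : ZMod 4).val = 3 from rfl, Complex.ext_iff, pow_succ] at ha
  intro a b hab
  refine sub_eq_zero.mp (h _ (mul_right_cancel₀ (pow_ne_zero b.val Complex.I_ne_zero) ?_))
  rw [← I_pow_val_add, sub_add_cancel, one_mul]
  exact hab

theorem neg_one_pow_val_injective : Function.Injective fun a : ZMod 2 => (-1 : ℂ) ^ a.val := by
  have h (a : ZMod 2) : a = 0 ∨ a = 1 := by revert a; decide
  intro a b hab
  rcases h a with rfl | rfl <;> rcases h b with rfl | rfl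
  · rfl
  · norm_num [show (1 : ZMod 2).val = 1 from rfl] at hab
  · norm_num [show (1 : ZMod 2).val = 1 from rfl] at hab
  · rfl

theorem dotF2_add_left {n : ℕ} (a b c : Fin n → ZMod 2) :
    dotF2 (a + b) c = dotF2 a c + dotF2 b c := by
  simp [dotF2, add_mul, Finset.sum_add_distrib]

theorem dotF2_add_right {n : ℕ} (a b c : Fin n → ZMod 2) :
    dotF2 a (b + c) = dotF2 a b + dotF2 a c := by
  simp [dotF2, mul_add, Finset.sum_add_distrib]

@[simp]
theorem dotF2_zero_left {n : ℕ} (a : Fin n → ZMod 2) : dotF2 0 a = 0 := by simp [dotF2]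

@[simp]
theorem dotF2_zero_right {n : ℕ} (a : Fin n → ZMod 2) : dotF2 a 0 = 0 := by simp [dotF2]

@[simp]
theorem dotF2_eVec {n : ℕ} (a : Fin n → ZMod 2) (k : Fin n) : dotF2 a (eVec k) = a k := by
  simp [dotF2, eVec]

theorem pauliOf_gop {n : ℕ} (p q : GG n) : pauliOf (gop p q) = pauliOf p * pauliOf q := by
  ext u v
  rw [Matrix.mul_apply, Finset.sum_eq_single (v + q.2.1)]
  · simp only [pauliOf, gop, PauliOp, I_pow_val_add, I_pow_val_two_mul_lift24, dotF2_add_left,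
      dotF2_add_right, neg_one_pow_val_add, add_assoc, add_comm p.2.1 q.2.1, if_true]
    ring
  · intro w _ hw
    simp [pauliOf, PauliOp, hw]
  · simp

theorem pauliOf_injective {n : ℕ} : Function.Injective (pauliOf (n := n)) := by
  rintro ⟨ε, ξ, ζ⟩ ⟨ε', ξ', ζ'⟩ h
  have entry (u v : Fin n → ZMod 2) : PauliOp ε ξ ζ u v = PauliOp ε' ξ' ζ' u v :=
    congrFun (congrFun h u) v
  have hξ : ξ = ξ' := by
    by_contra hne
    have h0 := entry ξ 0
    simp [PauliOp, hne] at h0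
  subst hξ
  have hε : ε = ε' := I_pow_val_injective (by simpa [PauliOp] using entry ξ 0)
  subst hε
  have hζ : ζ = ζ' := by
    funext k
    refine neg_one_pow_val_injective ?_
    simpa [PauliOp] using entry (eVec k + ξ) (eVec k)
  rw [hζ]

theorem pauliOf_phase {n : ℕ} (ε : ZMod 4) :
    pauliOf ((ε, 0, 0) : GG n) = Complex.I ^ ε.val • (1 : PMat n) := by
  ext u v
  simp [pauliOf, PauliOp, Matrix.one_apply]

theorem gens_zero (n : ℕ) : gens n 0 = pauliOf (1, 0, 0) := by
  rw [pauliOf_phase, show (1 : ZMod 4).val = 1 from rfl, pow_one]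
  simp [gens]

theorem gens_succ {n : ℕ} (i : Fin (2 * n)) : gens n i.succ = pauliOf (genTuple i) := by
  by_cases h : i.val < n
  · simp [gens, genTuple, pauliOf, h]
  · simp [gens, genTuple, pauliOf, h]

theorem pauliOf_foldl_gop {n : ℕ} (l : List (GG n)) (a : GG n) :
    pauliOf (l.foldl gop a) = pauliOf a * (l.map pauliOf).prod := by
  induction l generalizing a with
  | nil => simp
  | cons p l ih => simp [ih, pauliOf_gop, mul_assoc]

/-- When no reordering phase occurs, the iterated product in `GG n` is the componentwise sum. -/
theorem foldl_gop_eq_add_sum {n : ℕ} (l : List (GG n)) (a : GG n)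
    (ha : ∀ q ∈ l, dotF2 a.2.2 q.2.1 = 0)
    (hl : l.Pairwise fun p q => dotF2 p.2.2 q.2.1 = 0) :
    l.foldl gop a = a + l.sum := by
  induction l generalizing a with
  | nil => simp
  | cons p l ih =>
    rw [List.pairwise_cons] at hl
    have hap : gop a p = a + p := by
      have h := ha p (by simp)
      ext <;> simp [gop, h, lift24]
    rw [List.foldl_cons, List.sum_cons, ← add_assoc, hap]
    refine ih _ (fun q hq => ?_) hl.2
    rw [Prod.snd_add, Prod.snd_add, dotF2_add_left, ha q (by simp [hq]), hl.1 q hq, add_zero]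

theorem dotF2_genTuple_of_lt {n : ℕ} {i j : Fin (2 * n)} (h : i < j) :
    dotF2 (genTuple i).2.2 (genTuple j).2.1 = 0 := by
  by_cases hi : i.val < n
  · simp [genTuple, hi]
  · have hj : ¬ j.val < n := by
      have : i.val < j.val := h
      omega
    simp [genTuple, hj]

theorem sum_genTuple {n : ℕ} (ϱ : GG n) :
    ∑ i : Fin (2 * n), (if bitOf ϱ i = 1 then genTuple i else 0) = (0, ϱ.2.1, ϱ.2.2) := by
  have key (x : ZMod 2) : (if x = 1 then (1 : ZMod 2) else 0) = x := by revert x; decide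
  refine Prod.ext ?_ (Prod.ext (funext fun k => ?_) (funext fun k => ?_))
  · rw [Prod.fst_sum]
    refine Finset.sum_eq_zero fun i _ => ?_
    unfold genTuple
    split_ifs <;> rfl
  · rw [Prod.snd_sum, Prod.fst_sum, Finset.sum_apply,
      Finset.sum_eq_single ⟨k.val, by have := k.isLt; omega⟩]
    · rw [← key (ϱ.2.1 k)]
      simp only [bitOf, genTuple, k.isLt, dite_true]
      split_ifs <;> simp [eVec]
    · intro i _ hi
      have hne : k.val ≠ i.val := fun h => hi (Fin.ext h.symm)
      unfold genTuple
      split_ifs <;> simp [eVec, Fin.ext_iff, hne]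
    · simp
  · rw [Prod.snd_sum, Prod.snd_sum, Finset.sum_apply,
      Finset.sum_eq_single ⟨n + k.val, by have := k.isLt; omega⟩]
    · rw [← key (ϱ.2.2 k)]
      simp only [bitOf, genTuple, Nat.not_lt.mpr (Nat.le_add_right n k.val), dite_false,
        Nat.add_sub_cancel_left]
      split_ifs <;> simp [eVec]
    · intro i _ hi
      have hne (h : ¬ i.val < n) : k.val ≠ i.val - n := fun h' => hi (Fin.ext (by simp; omega))
      unfold genTuple
      split_ifs with _ h <;> simp [eVec, Fin.ext_iff]
      exact hne h
    · simp

/-- Every element of `GG n` is the ordered product of its phase and its generators. -/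
theorem foldl_gop_genTuple {n : ℕ} (ϱ : GG n) :
    (((List.finRange (2 * n)).filter fun i => decide (bitOf ϱ i = 1)).map genTuple).foldl gop
      (ϱ.1, 0, 0) = ϱ := by
  rw [foldl_gop_eq_add_sum _ _ (by simp)]
  · have hsum := List.sum_map_ite (fun i => bitOf ϱ i = 1) genTuple (fun _ => 0)
      (List.finRange (2 * n))
    rw [← Fin.sum_univ_def, sum_genTuple, List.sum_map_zero, add_zero] at hsum
    rw [← hsum]
    ext <;> simp
  · rw [List.pairwise_map]
    exact ((List.pairwise_lt_finRange _).filter _).imp dotF2_genTuple_of_lt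

theorem conj_list_prod {n : ℕ} {C : PMat n} (hC : IsCliffordUnitary C) (l : List (PMat n)) :
    (l.map fun A => Cᴴ * A * C).prod = Cᴴ * l.prod * C := by
  induction l with
  | nil => simp [hC.2.1]
  | cons A l ih =>
    rw [List.map_cons, List.prod_cons, List.prod_cons, ih]
    calc Cᴴ * A * C * (Cᴴ * l.prod * C) = Cᴴ * A * (C * Cᴴ) * l.prod * C := by
          simp only [mul_assoc]
      _ = Cᴴ * (A * l.prod) * C := by rw [hC.1, mul_one, mul_assoc Cᴴ]

theorem IsFlowTableau.zero_eq {n : ℕ} {C : PMat n} (hC : IsCliffordUnitary C)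
    {M : Fin (2 * n + 1) → GG n} (hM : IsFlowTableau C M) : M 0 = (1, 0, 0) := by
  refine pauliOf_injective ((hM 0).trans ?_)
  rw [gens_zero, pauliOf_phase, Matrix.mul_smul, Matrix.smul_mul, mul_one, hC.2.1]

/-- The vector–tableau product with the flow tableau of `C` presents conjugation by `C`. -/
theorem IsFlowTableau.pauliOf_starVecMul {n : ℕ} {C : PMat n} (hC : IsCliffordUnitary C)
    {M : Fin (2 * n + 1) → GG n} (hM : IsFlowTableau C M) (ϱ : GG n) :
    pauliOf (starVecMul ϱ M) = Cᴴ * pauliOf ϱ * C := by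
  have hrow (i : Fin (2 * n)) : pauliOf (M i.succ) = Cᴴ * pauliOf (genTuple i) * C := by
    rw [← gens_succ]
    exact hM i.succ
  have hprod (l : List (Fin (2 * n))) : ((l.map fun i => M i.succ).map pauliOf).prod =
      Cᴴ * ((l.map genTuple).map pauliOf).prod * C := by
    rw [← conj_list_prod hC]
    simp [Function.comp_def, hrow]
  rw [starVecMul, pauliOf_foldl_gop, hprod, hM.zero_eq hC, mul_one]
  conv_rhs => rw [← foldl_gop_genTuple ϱ, pauliOf_foldl_gop]
  simp only [pauliOf_phase, Matrix.smul_mul, Matrix.mul_smul, one_mul]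

/-- for Clifford unitaries C, C′, the flow tableau of C′·C is the
row-wise ⊛-product F(C′) ⊛ F(C). -/
theorem stmt15 (n : ℕ) (hn : 1 ≤ n) (C C' : PMat n)
    (hC : IsCliffordUnitary C) (hC' : IsCliffordUnitary C')
    (M M' M'' : Fin (2 * n + 1) → GG n)
    (hM : IsFlowTableau C M) (hM' : IsFlowTableau C' M')
    (hM'' : IsFlowTableau (C' * C) M'') :
    M'' = fun i => starVecMul (M' i) M := by
  funext i
  refine pauliOf_injective ((hM'' i).trans ?_)
  rw [hM.pauliOf_starVecMul hC, pauliOf, hM' i, Matrix.conjTranspose_mul]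
  simp only [mul_assoc]
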